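/- Let 1 < p ≤ ∞ and let μ be a locally finite Borel measure on ℝ^d. Then the dyadic (real-valued) Hardy–Littlewood maximal operator M^μ h := sup_{Q∈𝒟} ⟨h⟩^μ_Q 1_Q, over any finite collection 𝒟 of dyadic cubes, satisfies ‖M^μ‖_{L^p(μ)→L^p(μ)} ≤ p', where p' is the conjugate exponent of p. -/

import Mathlib

open MeasureTheory ENNReal
open scoped Classical

/-- A dyadic cube `2^{-k}([0,1)^d + j)` in `ℝ^d`, encoded by its scale `k` and position `j`. -/
structure DCube (d : ℕ) where
  k : ℤ
  j : Fin d → ℤ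
deriving DecidableEq

namespace DCube
variable {d : ℕ}

/-- The dyadic cube as a subset of `ℝ^d`. -/
def toSet (Q : DCube d) : Set (Fin d → ℝ) :=
  {x | ∀ i, (2:ℝ) ^ (-Q.k) * Q.j i ≤ x i ∧ x i < (2:ℝ) ^ (-Q.k) * (Q.j i + 1)}

/-- The dyadic parent of a dyadic cube. -/
def parent (Q : DCube d) : DCube d := ⟨Q.k - 1, fun i => Int.fdiv (Q.j i) 2⟩

end DCube

/-- The `μ`-average `⟨f⟩^μ_Q` of a vector-valued function over a dyadic cube. -/
noncomputable def cubeAvg {d : ℕ} {E : Type*} [NormedAddCommGroup E] [NormedSpace ℝ E]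
    (μ : Measure (Fin d → ℝ)) (Q : DCube d) (f : (Fin d → ℝ) → E) : E :=
  (μ Q.toSet).toReal⁻¹ • ∫ x in Q.toSet, f x ∂μ

/-- The dyadic lattice Hardy–Littlewood maximal operator
`M̄^μ_𝒟 f = sup_{Q ∈ 𝒟} ⟨f⟩^μ_Q 1_Q`, the (finite) supremum being taken in the lattice order
(and equal to `0` where no cube of `𝒟` is present). -/
noncomputable def maximalFn {d : ℕ} {E : Type*} [NormedAddCommGroup E] [Lattice E]
    [NormedSpace ℝ E] (μ : Measure (Fin d → ℝ)) (𝒟 : Finset (DCube d))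
    (f : (Fin d → ℝ) → E) (x : Fin d → ℝ) : E :=
  if h : 𝒟.Nonempty then 𝒟.sup' h (fun Q => Q.toSet.indicator (fun _ => cubeAvg μ Q f) x) else 0

open scoped NNReal

namespace DCube
variable {d : ℕ}

lemma measurableSet_toSet (Q : DCube d) : MeasurableSet Q.toSet := by
  unfold toSet
  measurability

lemma measure_toSet_ne_top (μ : Measure (Fin d → ℝ)) [IsLocallyFiniteMeasure μ] (Q : DCube d) :
    μ Q.toSet ≠ ∞ := by
  refine ((measure_mono (t := Set.Icc (fun i => (2:ℝ) ^ (-Q.k) * Q.j i)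
    (fun i => (2:ℝ) ^ (-Q.k) * (Q.j i + 1))) ?_).trans_lt isCompact_Icc.measure_lt_top).ne
  exact fun x hx => ⟨fun i => (hx i).1, fun i => (hx i).2.le⟩

lemma mem_toSet_iff {Q : DCube d} {x : Fin d → ℝ} :
    x ∈ Q.toSet ↔ ∀ i, ⌊(2:ℝ) ^ Q.k * x i⌋ = Q.j i := by
  refine forall_congr' fun i => ?_
  have h2 : (0:ℝ) < 2 ^ Q.k := by positivity
  rw [Int.floor_eq_iff, zpow_neg, inv_mul_le_iff₀ h2, lt_inv_mul_iff₀ h2]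

lemma toSet_subset_or_disjoint_of_le {Q R : DCube d} (hQR : Q.k ≤ R.k) :
    R.toSet ⊆ Q.toSet ∨ Disjoint R.toSet Q.toSet := by
  refine or_iff_not_imp_right.2 fun hd => ?_
  obtain ⟨x, hxR, hxQ⟩ := Set.not_disjoint_iff.1 hd
  obtain ⟨n, hn⟩ := Int.eq_ofNat_of_zero_le (sub_nonneg.2 hQR)
  have key (z : ℝ) : ⌊(2:ℝ) ^ Q.k * z⌋ = ⌊(2:ℝ) ^ R.k * z⌋ / (2 ^ n : ℕ) := by
    rw [← Int.floor_div_natCast]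
    congr 1
    have : R.k = Q.k + n := by omega
    rw [this, zpow_add₀ two_ne_zero]
    push_cast
    rw [zpow_natCast]
    field_simp
  rw [mem_toSet_iff] at hxR hxQ
  intro y hy
  rw [mem_toSet_iff] at hy ⊢
  intro i
  rw [key, hy i, ← hxR i, ← key, hxQ i]

lemma toSet_subset_or_subset_or_disjoint (Q R : DCube d) :
    Q.toSet ⊆ R.toSet ∨ R.toSet ⊆ Q.toSet ∨ Disjoint Q.toSet R.toSet := by
  rcases le_total Q.k R.k with h | h
  · have := toSet_subset_or_disjoint_of_le h
    rw [disjoint_comm] at this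
    exact Or.inr this
  · rcases toSet_subset_or_disjoint_of_le h with h | h
    · exact Or.inl h
    · exact Or.inr (Or.inr h)

end DCube

lemma Finset.measurable_fun_sup {α β ι : Type*} [MeasurableSpace α] [MeasurableSpace β]
    [SemilatticeSup β] [OrderBot β] [MeasurableSup₂ β] (G : Finset ι) {f : ι → α → β}
    (hf : ∀ i ∈ G, Measurable (f i)) : Measurable fun x => G.sup fun i => f i x := by
  simp_rw [← Finset.sup_apply]
  exact Finset.sup_induction measurable_const (fun _ hf _ hg => hf.sup hg) hf

section Laminar
variable {α ι : Type*}

/-- The largest weight `a i` among the members `s i`, `i ∈ G`, that contain the point. -/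
noncomputable def finsetMaximal (G : Finset ι) (s : ι → Set α) (a : ι → ℝ≥0) (x : α) : ℝ≥0 :=
  G.sup fun i => (s i).indicator (fun _ => a i) x

lemma setOf_lt_finsetMaximal (G : Finset ι) (s : ι → Set α) (a : ι → ℝ≥0) (t : ℝ≥0) :
    {x | t < finsetMaximal G s a x} = ⋃ i ∈ G.filter (fun i => t < a i), s i := by
  ext x
  simp only [finsetMaximal, Set.mem_ofPred_eq, Finset.lt_sup_iff, Set.mem_iUnion,
    Finset.mem_filter, exists_prop, and_assoc]
  refine exists_congr fun i => and_congr_right fun _ => ?_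
  by_cases hx : x ∈ s i <;> simp [hx]

variable [MeasurableSpace α]

/-- For a finite laminar family, a measure domination on each member passes to the union. -/
lemma mul_measure_biUnion_le_of_laminar {μ ν : Measure α} {s : ι → Set α} {t : ℝ≥0∞}
    (hs : ∀ i, MeasurableSet (s i))
    (hlam : ∀ i j, s i ⊆ s j ∨ s j ⊆ s i ∨ Disjoint (s i) (s j)) (H : Finset ι)
    (hH : ∀ i ∈ H, t * μ (s i) ≤ ν (s i)) :
    t * μ (⋃ i ∈ H, s i) ≤ ν (⋃ i ∈ H, s i) := by
  induction H using Finset.strongInduction with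
  | H H ih =>
    by_cases hex : ∃ i ∈ H, ∃ j ∈ H, i ≠ j ∧ s i ⊆ s j
    · obtain ⟨i, hi, j, hj, hij, hsub⟩ := hex
      have hU : ⋃ k ∈ H, s k = ⋃ k ∈ H.erase i, s k := by
        conv_lhs => rw [← Finset.insert_erase hi, Finset.set_biUnion_insert]
        exact Set.union_eq_right.2 (hsub.trans
          (Set.subset_biUnion_of_mem (u := s) (Finset.mem_erase.2 ⟨hij.symm, hj⟩)))
      rw [hU]
      exact ih _ (Finset.erase_ssubset hi) fun k hk => hH k (Finset.mem_of_mem_erase hk)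
    · push Not at hex
      have hdis : (H : Set ι).PairwiseDisjoint s := fun i hi j hj hij =>
        ((hlam i j).resolve_left (hex i hi j hj hij)).resolve_left (hex j hj i hi hij.symm)
      rw [measure_biUnion_finset hdis fun i _ => hs i,
        measure_biUnion_finset hdis fun i _ => hs i, Finset.mul_sum]
      exact Finset.sum_le_sum hH

lemma measurable_finsetMaximal (G : Finset ι) {s : ι → Set α} (a : ι → ℝ≥0)
    (hs : ∀ i, MeasurableSet (s i)) : Measurable (finsetMaximal G s a) := by
  unfold finsetMaximal
  refine Finset.measurable_fun_sup _ fun i _ => measurable_const.indicator (hs i)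

/-- Weak-type estimate for the maximal function of a finite laminar family. -/
lemma mul_measure_lt_finsetMaximal_le {μ ν : Measure α} {s : ι → Set α} {a : ι → ℝ≥0}
    (hs : ∀ i, MeasurableSet (s i))
    (hlam : ∀ i j, s i ⊆ s j ∨ s j ⊆ s i ∨ Disjoint (s i) (s j)) (G : Finset ι)
    (hG : ∀ i ∈ G, a i * μ (s i) ≤ ν (s i)) (t : ℝ≥0) :
    t * μ {x | t < finsetMaximal G s a x} ≤ ν {x | t < finsetMaximal G s a x} := by
  rw [setOf_lt_finsetMaximal]
  refine mul_measure_biUnion_le_of_laminar hs hlam _ fun i hi => ?_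
  rw [Finset.mem_filter] at hi
  refine le_trans ?_ (hG i hi.1)
  gcongr
  exact hi.2.le

lemma lintegral_finsetMaximal_rpow_ne_top {μ : Measure α} {s : ι → Set α} {a : ι → ℝ≥0}
    (hs : ∀ i, MeasurableSet (s i)) (hfin : ∀ i, μ (s i) ≠ ∞) (G : Finset ι) {r : ℝ} (hr : 0 < r) :
    ∫⁻ x, (finsetMaximal G s a x : ℝ≥0∞) ^ r ∂μ ≠ ∞ := by
  have hle (x : α) : (finsetMaximal G s a x : ℝ≥0∞) ^ r ≤
      ∑ i ∈ G, (s i).indicator (fun _ => (a i : ℝ≥0∞) ^ r) x := by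
    rcases G.eq_empty_or_nonempty with rfl | hne
    · simp [finsetMaximal, hr]
    obtain ⟨i, hi, hx⟩ := G.exists_mem_eq_sup hne fun i => (s i).indicator (fun _ => a i) x
    refine le_trans (le_of_eq ?_)
      (Finset.single_le_sum (f := fun i => (s i).indicator (fun _ => (a i : ℝ≥0∞) ^ r) x)
        (fun _ _ => zero_le) hi)
    rw [finsetMaximal, hx]
    by_cases h : x ∈ s i <;> simp [h, hr]
  refine ne_top_of_le_ne_top ?_ (lintegral_mono hle)
  rw [lintegral_finsetSum _ fun i _ => measurable_const.indicator (hs i)]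
  refine ENNReal.sum_ne_top.2 fun i _ => ?_
  rw [lintegral_indicator_const (hs i)]
  exact ENNReal.mul_ne_top (ENNReal.rpow_ne_top_of_nonneg hr.le ENNReal.coe_ne_top) (hfin i)

end Laminar

/-- Doob's argument: a weak-type estimate against `ν` self-improves to a strong-type one. -/
lemma lintegral_rpow_le_of_weak_type {α : Type*} [MeasurableSpace α] {μ ν : Measure α}
    {F : α → ℝ≥0} (hF : Measurable F) (hweak : ∀ t : ℝ≥0, t * μ {x | t < F x} ≤ ν {x | t < F x})
    {r : ℝ} (hr : 1 < r) :
    ∫⁻ x, (F x : ℝ≥0∞) ^ r ∂μ ≤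
      ENNReal.ofReal (r / (r - 1)) * ∫⁻ x, (F x : ℝ≥0∞) ^ (r - 1) ∂ν := by
  have layer (m : Measure α) {q : ℝ} (hq : 0 < q) : ∫⁻ x, (F x : ℝ≥0∞) ^ q ∂m =
      ENNReal.ofReal q * ∫⁻ t in Set.Ioi (0:ℝ), m {x | t < F x} * ENNReal.ofReal (t ^ (q - 1)) := by
    rw [← lintegral_rpow_eq_lintegral_meas_lt_mul m
      (Filter.Eventually.of_forall fun x => (F x).coe_nonneg) hF.coe_nnreal_real.aemeasurable hq]
    refine lintegral_congr fun x => ?_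
    rw [← ENNReal.ofReal_rpow_of_nonneg (F x).coe_nonneg hq.le]
    simp
  rw [layer μ (by linarith), layer ν (by linarith), ← mul_assoc,
    ← ENNReal.ofReal_mul (by positivity [sub_pos.2 hr]), div_mul_cancel₀ _ (by linarith)]
  gcongr ENNReal.ofReal r * ?_
  refine setLIntegral_mono' measurableSet_Ioi fun t (ht : 0 < t) => ?_
  lift t to ℝ≥0 using ht.le
  have hpow : (t:ℝ) ^ (r - 1) = t * (t:ℝ) ^ (r - 1 - 1) := by
    rw [← Real.rpow_one_add' t.coe_nonneg (by linarith)]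
    ring_nf
  rw [hpow, ENNReal.ofReal_mul t.coe_nonneg, ← mul_assoc, mul_comm (μ _)]
  gcongr
  simpa using hweak t

lemma rpow_lintegral_le_of_weak_type {α : Type*} [MeasurableSpace α] {μ : Measure α}
    {F : α → ℝ≥0} (hF : Measurable F) {g : α → ℝ≥0∞} (hg : Measurable g)
    (hweak : ∀ t : ℝ≥0, t * μ {x | t < F x} ≤ μ.withDensity g {x | t < F x})
    {r : ℝ} (hr : 1 < r) (hfin : ∫⁻ x, (F x : ℝ≥0∞) ^ r ∂μ ≠ ∞) :
    (∫⁻ x, (F x : ℝ≥0∞) ^ r ∂μ) ^ (1 / r) ≤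
      ENNReal.ofReal (r / (r - 1)) * (∫⁻ x, g x ^ r ∂μ) ^ (1 / r) := by
  set I := ∫⁻ x, (F x : ℝ≥0∞) ^ r ∂μ with hI
  have hr0 : 0 < r := by linarith
  rcases eq_or_ne I 0 with h0 | h0
  · rw [h0, ENNReal.zero_rpow_of_pos (by positivity)]
    exact zero_le
  have hFm : Measurable fun x => (F x : ℝ≥0∞) ^ (r - 1) := hF.coe_nnreal_ennreal.pow_const _
  have hq : r.HolderConjugate (r / (r - 1)) := Real.HolderConjugate.conjExponent hr
  have hmain := lintegral_rpow_le_of_weak_type hF hweak hr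
  rw [lintegral_withDensity_eq_lintegral_mul _ hg hFm] at hmain
  have hold := ENNReal.lintegral_mul_le_Lp_mul_Lq μ hq hg.aemeasurable hFm.aemeasurable
  have hexp : ∀ x, ((F x : ℝ≥0∞) ^ (r - 1)) ^ (r / (r - 1)) = (F x : ℝ≥0∞) ^ r := fun x => by
    rw [← ENNReal.rpow_mul, mul_div_cancel₀ _ (by linarith)]
  simp only [hexp, ← hI] at hold
  have hsplit : I = I ^ (1 / r) * I ^ (1 / (r / (r - 1))) := by
    rw [← ENNReal.rpow_add _ _ h0 hfin, one_div, one_div, hq.inv_add_inv_eq_one, ENNReal.rpow_one]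
  have hne0 : I ^ (1 / (r / (r - 1))) ≠ 0 := by simp [h0, hfin]
  have hnet : I ^ (1 / (r / (r - 1))) ≠ ∞ := by simp [h0, hfin]
  rw [← ENNReal.mul_le_mul_iff_left hne0 hnet, ← hsplit, mul_assoc]
  exact hmain.trans (by gcongr)

lemma enorm_maximalFn_le {d : ℕ} (μ : Measure (Fin d → ℝ)) (𝒟 : Finset (DCube d))
    (h : (Fin d → ℝ) → ℝ) (x : Fin d → ℝ) :
    ‖maximalFn μ 𝒟 h x‖ₑ ≤ finsetMaximal 𝒟 DCube.toSet (fun Q => ‖cubeAvg μ Q h‖₊) x := by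
  rw [enorm_eq_nnnorm, ENNReal.coe_le_coe]
  unfold maximalFn
  split_ifs with hne
  · obtain ⟨Q, hQ, hx⟩ := 𝒟.exists_mem_eq_sup' hne
      fun Q => Q.toSet.indicator (fun _ => cubeAvg μ Q h) x
    rw [hx, nnnorm_indicator_eq_indicator_nnnorm]
    exact Finset.le_sup (f := fun Q : DCube d => Q.toSet.indicator (fun _ => ‖cubeAvg μ Q h‖₊) x) hQ
  · simp

lemma enorm_cubeAvg_mul_measure_le {d : ℕ} {E : Type*} [NormedAddCommGroup E] [NormedSpace ℝ E]
    (μ : Measure (Fin d → ℝ)) (Q : DCube d) (h : (Fin d → ℝ) → E) :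
    ‖cubeAvg μ Q h‖ₑ * μ Q.toSet ≤ ∫⁻ x in Q.toSet, ‖h x‖ₑ ∂μ := by
  rcases eq_or_ne (μ Q.toSet) 0 with h0 | h0
  · simp [h0]
  rcases eq_or_ne (μ Q.toSet) ∞ with ht | ht
  · simp [cubeAvg, ht]
  rw [cubeAvg, enorm_smul, Real.enorm_of_nonneg (by positivity),
    ENNReal.ofReal_inv_of_pos (ENNReal.toReal_pos h0 ht), ENNReal.ofReal_toReal ht, mul_right_comm,
    ENNReal.inv_mul_cancel h0 ht, one_mul]
  exact enorm_integral_le_lintegral_enorm _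

lemma enorm_cubeAvg_le_eLpNormEssSup {d : ℕ} {E : Type*} [NormedAddCommGroup E] [NormedSpace ℝ E]
    (μ : Measure (Fin d → ℝ)) (Q : DCube d) (h : (Fin d → ℝ) → E) :
    ‖cubeAvg μ Q h‖ₑ ≤ eLpNormEssSup h μ := by
  rcases eq_or_ne (μ Q.toSet) 0 with h0 | h0
  · simp [cubeAvg, h0]
  rcases eq_or_ne (μ Q.toSet) ∞ with ht | ht
  · simp [cubeAvg, ht]
  rw [← ENNReal.mul_le_mul_iff_left h0 ht]
  refine (enorm_cubeAvg_mul_measure_le μ Q h).trans ?_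
  rw [← setLIntegral_const]
  exact lintegral_mono_ae (ae_restrict_of_ae (ae_le_eLpNormEssSup (f := h)))

/-- A function need not be measurable to admit a measurable minorant with at least the same lower
integral on finitely many given sets. -/
lemma exists_measurable_le_setLIntegral_le {α ι : Type*} [MeasurableSpace α] (μ : Measure α)
    (G : Finset ι) (s : ι → Set α) (f : α → ℝ≥0∞) :
    ∃ g : α → ℝ≥0∞, Measurable g ∧ g ≤ f ∧
      ∀ i ∈ G, ∫⁻ x in s i, f x ∂μ ≤ ∫⁻ x in s i, g x ∂μ := by
  choose g hgm hgf hg using fun i => exists_measurable_le_lintegral_eq (μ.restrict (s i)) f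
  refine ⟨fun x => G.sup fun i => g i x, Finset.measurable_fun_sup _ fun i _ => hgm i,
    fun x => Finset.sup_le fun i _ => hgf i x, fun i hi => ?_⟩
  rw [hg i]
  exact lintegral_mono fun x => Finset.le_sup (f := fun i => g i x) hi

/-- **Universal norm bound for the dyadic (real-valued) Hardy–Littlewood maximal operator.**
Let `1 < p ≤ ∞` and let `μ` be a locally finite Borel measure on `ℝ^d`.  Then, for any finite
collection `𝒟` of dyadic cubes, `‖M^μ_𝒟 h‖_{L^p(μ)} ≤ p' ‖h‖_{L^p(μ)}`, where
`p' = (1 - 1/p)⁻¹` is the conjugate exponent of `p`. -/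
theorem dyadic_maximal_universal_bound (d : ℕ) (p : ℝ≥0∞) (hp : 1 < p)
    (μ : Measure (Fin d → ℝ)) [IsLocallyFiniteMeasure μ]
    (𝒟 : Finset (DCube d)) (h : (Fin d → ℝ) → ℝ) :
    eLpNorm (maximalFn μ 𝒟 h) p μ ≤ (1 - p⁻¹)⁻¹ * eLpNorm h p μ := by
  rcases eq_or_ne p ∞ with rfl | hpt
  · simp only [ENNReal.inv_top, tsub_zero, inv_one, one_mul, eLpNorm_exponent_top]
    refine essSup_le_of_ae_le _ ?_
    filter_upwards with x
    refine (enorm_maximalFn_le μ 𝒟 h x).trans ?_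
    rw [finsetMaximal, ENNReal.coe_finset_sup]
    refine Finset.sup_le fun Q _ => ?_
    refine le_trans (ENNReal.coe_le_coe.2 (Set.indicator_le_self _ _ x)) ?_
    exact enorm_cubeAvg_le_eLpNormEssSup μ Q h
  obtain ⟨g, hgm, hgh, hg⟩ :=
    exists_measurable_le_setLIntegral_le μ 𝒟 DCube.toSet fun x => ‖h x‖ₑ
  have hp0 : p ≠ 0 := (zero_lt_one.trans hp).ne'
  have hr : 1 < p.toReal := by
    rwa [← ENNReal.toReal_one, ENNReal.toReal_lt_toReal ENNReal.one_ne_top hpt]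
  have hconst : ENNReal.ofReal (p.toReal / (p.toReal - 1)) = (1 - p⁻¹)⁻¹ := by
    conv_rhs => rw [← ENNReal.ofReal_toReal hpt]
    rw [← ENNReal.ofReal_inv_of_pos (by linarith), ← ENNReal.ofReal_one,
      ← ENNReal.ofReal_sub _ (by positivity),
      ← ENNReal.ofReal_inv_of_pos (sub_pos.2 (inv_lt_one_of_one_lt₀ hr))]
    congr 1
    have : p.toReal - 1 ≠ 0 := by linarith
    field_simp
  rw [eLpNorm_eq_lintegral_rpow_enorm_toReal hp0 hpt,
    eLpNorm_eq_lintegral_rpow_enorm_toReal hp0 hpt, ← hconst]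
  set a : DCube d → ℝ≥0 := fun Q => ‖cubeAvg μ Q h‖₊ with ha
  have hweak := mul_measure_lt_finsetMaximal_le (μ := μ) (ν := μ.withDensity g) (a := a)
    DCube.measurableSet_toSet DCube.toSet_subset_or_subset_or_disjoint 𝒟 fun Q hQ => by
      rw [withDensity_apply _ Q.measurableSet_toSet]
      exact (enorm_cubeAvg_mul_measure_le μ Q h).trans (hg Q hQ)
  refine le_trans ?_ ((rpow_lintegral_le_of_weak_type
    (measurable_finsetMaximal 𝒟 a DCube.measurableSet_toSet) hgm hweak hr
    (lintegral_finsetMaximal_rpow_ne_top DCube.measurableSet_toSet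
      (DCube.measure_toSet_ne_top μ) 𝒟 (by linarith))).trans ?_)
  · gcongr with x
    exact enorm_maximalFn_le μ 𝒟 h x
  · gcongr with x
    exact hgh x
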